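/- Fix an integer k ≥ 2 and β > 1, and equip Σ_k = (Fin k)^ℕ with the metric d_β(x,y) = 0 if x = y and d_β(x,y) = β^{-min{n ≥ 0 : x_n ≠ y_n}} otherwise. Let E ⊆ Σ_k satisfy σ(E) ⊆ E, where σ is the left shift. Then the Hausdorff dimension of E with respect to d_β satisfies dim_H E ≤ h_top(E) / log β, where h_top(E) is the topological entropy of the shift on the subset E. -/

import Mathlib

open Dynamics

/-- Type synonym for the full one-sided shift `Σ_k = (Fin k)^ℕ`, carrying the metric `d_β`. -/
def BetaSeq (k : ℕ) (β : ℝ) : Type := ℕ → Fin k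

namespace BetaSeq

variable {k : ℕ} {β : ℝ}

theorem exists_ne_of_ne {x y : BetaSeq k β} (h : x ≠ y) : ∃ n, x n ≠ y n :=
  Function.ne_iff.mp h

open Classical in
/-- The metric `d_β(x,y) = β^{-min{n : x_n ≠ y_n}}` (and `0` if `x = y`). -/
noncomputable def bdist (x y : BetaSeq k β) : ℝ :=
  if h : x = y then 0 else β ^ (-(Nat.find (exists_ne_of_ne h) : ℤ))

theorem bdist_self (x : BetaSeq k β) : bdist x x = 0 := by
  unfold bdist; simp

theorem bdist_comm (x y : BetaSeq k β) : bdist x y = bdist y x := by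
  classical
  unfold bdist
  rcases eq_or_ne x y with rfl | h
  · simp
  · rw [dif_neg h, dif_neg (Ne.symm h)]
    have h1 : x (Nat.find (exists_ne_of_ne (Ne.symm h))) ≠
        y (Nat.find (exists_ne_of_ne (Ne.symm h))) :=
      Ne.symm (Nat.find_spec (exists_ne_of_ne (Ne.symm h)))
    have h2 : y (Nat.find (exists_ne_of_ne h)) ≠ x (Nat.find (exists_ne_of_ne h)) :=
      Ne.symm (Nat.find_spec (exists_ne_of_ne h))
    have hfind : Nat.find (exists_ne_of_ne h) = Nat.find (exists_ne_of_ne (Ne.symm h)) :=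
      le_antisymm (Nat.find_le h1) (Nat.find_le h2)
    rw [hfind]

theorem bdist_triangle (hβ : 1 < β) (x y z : BetaSeq k β) :
    bdist x z ≤ bdist x y + bdist y z := by
  classical
  have hβ0 : (0:ℝ) < β := lt_trans one_pos hβ
  have nonneg : ∀ a b : BetaSeq k β, 0 ≤ bdist a b := by
    intro a b
    unfold bdist
    rcases eq_or_ne a b with rfl | h
    · simp
    · rw [dif_neg h]; positivity
  rcases eq_or_ne x z with rfl | hxz
  · rw [bdist_self]
    have := nonneg x y; have := nonneg y x; linarith
  · rcases eq_or_ne x y with rfl | hxy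
    · rw [bdist_self, zero_add]
    · rcases eq_or_ne y z with rfl | hyz
      · rw [bdist_self, add_zero]
      · unfold bdist
        rw [dif_neg hxz, dif_neg hxy, dif_neg hyz]
        set m := Nat.find (exists_ne_of_ne hxz) with hm
        set n1 := Nat.find (exists_ne_of_ne hxy) with hn1
        set n2 := Nat.find (exists_ne_of_ne hyz) with hn2
        have key : n1 ≤ m ∨ n2 ≤ m := by
          by_contra hc
          push_neg at hc
          have hx' : x m = y m := by
            have := Nat.find_min (exists_ne_of_ne hxy) (hn1 ▸ hc.1)
            simpa using this
          have hy' : y m = z m := by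
            have := Nat.find_min (exists_ne_of_ne hyz) (hn2 ▸ hc.2)
            simpa using this
          exact (Nat.find_spec (exists_ne_of_ne hxz)) (hx'.trans hy')
        have pos1 : (0:ℝ) < β ^ (-(n1 : ℤ)) := zpow_pos hβ0 _
        have pos2 : (0:ℝ) < β ^ (-(n2 : ℤ)) := zpow_pos hβ0 _
        rcases key with hle | hle
        · have : β ^ (-(m : ℤ)) ≤ β ^ (-(n1 : ℤ)) := by
            apply zpow_le_zpow_right₀ hβ.le; omega
          linarith
        · have : β ^ (-(m : ℤ)) ≤ β ^ (-(n2 : ℤ)) := by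
            apply zpow_le_zpow_right₀ hβ.le; omega
          linarith

theorem eq_of_bdist_eq_zero (hβ : 1 < β) {x y : BetaSeq k β} (h : bdist x y = 0) : x = y := by
  classical
  by_contra hxy
  unfold bdist at h
  rw [dif_neg hxy] at h
  have : (0:ℝ) < β ^ (-(Nat.find (exists_ne_of_ne hxy) : ℤ)) :=
    zpow_pos (lt_trans one_pos hβ) _
  linarith

/-- `Σ_k` with the metric `d_β`, for `β > 1`. -/
noncomputable instance metricSpace [hβ : Fact (1 < β)] : MetricSpace (BetaSeq k β) where
  dist := bdist
  dist_self := bdist_self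
  dist_comm := bdist_comm
  dist_triangle := bdist_triangle hβ.out
  eq_of_dist_eq_zero := eq_of_bdist_eq_zero hβ.out

/-- The left shift on `Σ_k`. -/
def shift (x : BetaSeq k β) : BetaSeq k β := fun n => x (n + 1)

end BetaSeq

namespace BetaSeq

theorem dist_le_of_agree {k : ℕ} {β : ℝ} [hβ : Fact (1 < β)] {x y : BetaSeq k β} {n : ℕ}
    (h : ∀ i < n, x i = y i) : dist x y ≤ (β⁻¹) ^ n := by
  classical
  have hb := hβ.out
  have hβ0 : (0:ℝ) < β := lt_trans one_pos hb
  change bdist x y ≤ _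
  unfold bdist
  split_ifs with hxy
  · positivity
  · have hle : n ≤ Nat.find (exists_ne_of_ne hxy) := by
      by_contra hc
      push Not at hc
      exact Nat.find_spec (exists_ne_of_ne hxy) (h _ hc)
    rw [inv_pow, ← zpow_natCast, ← zpow_neg]
    apply zpow_le_zpow_right₀ hb.le
    omega

theorem agree_of_dist_lt {k : ℕ} {β : ℝ} [hβ : Fact (1 < β)] {x y : BetaSeq k β} {n : ℕ}
    (h : dist x y < (β⁻¹) ^ n) : ∀ i ≤ n, x i = y i := by
  classical
  have hb := hβ.out
  have hβ0 : (0:ℝ) < β := lt_trans one_pos hb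
  intro i hi
  by_contra hne
  have hxy : x ≠ y := fun e => hne (by rw [e])
  change bdist x y < _ at h
  unfold bdist at h
  rw [dif_neg hxy, inv_pow, ← zpow_natCast, ← zpow_neg, zpow_lt_zpow_iff_right₀ hb] at h
  have := Nat.find_le (h := exists_ne_of_ne hxy) hne
  omega

theorem shift_iterate {k : ℕ} {β : ℝ} (x : BetaSeq k β) (j i : ℕ) :
    (shift^[j] x) i = x (j + i) := by
  induction j generalizing x with
  | zero => simp
  | succ j ih =>
    rw [Function.iterate_succ_apply, ih]
    change x (j + i + 1) = _
    congr 1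
    omega

/-- The entourage of pairs of sequences which agree on the first `m` symbols. -/
def agree (k : ℕ) (β : ℝ) (m : ℕ) : SetRel (BetaSeq k β) (BetaSeq k β) :=
  {p | ∀ i < m, p.1 i = p.2 i}

theorem agree_mem {k : ℕ} {β : ℝ} [hβ : Fact (1 < β)] (m : ℕ) :
    agree k β m ∈ uniformity (BetaSeq k β) := by
  have hβ0 : (0:ℝ) < β := lt_trans one_pos hβ.out
  refine Metric.mem_uniformity_dist.2 ⟨(β⁻¹) ^ m, by positivity, ?_⟩
  intro a b hab i hi
  exact agree_of_dist_lt hab i hi.le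

theorem exists_agree_subset {k : ℕ} {β : ℝ} [hβ : Fact (1 < β)]
    {U : SetRel (BetaSeq k β) (BetaSeq k β)} (hU : U ∈ uniformity (BetaSeq k β)) :
    ∃ m, agree k β m ⊆ U := by
  have hβ0 : (0:ℝ) < β := lt_trans one_pos hβ.out
  obtain ⟨ε, hε, h⟩ := Metric.mem_uniformity_dist.1 hU
  obtain ⟨m, hm⟩ := exists_pow_lt_of_lt_one hε (inv_lt_one_of_one_lt₀ hβ.out)
  exact ⟨m, fun p hp => h ((dist_le_of_agree hp).trans_lt hm)⟩

theorem coverMincard_agree_le {k : ℕ} (hk : 2 ≤ k) {β : ℝ} [hβ : Fact (1 < β)]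
    (E : Set (BetaSeq k β)) (m n : ℕ) :
    coverMincard shift E (agree k β m) n ≤ ((k ^ (m + n) : ℕ) : ℕ∞) := by
  classical
  let f : (Fin (m + n) → Fin k) → BetaSeq k β :=
    fun w i => if h : i < m + n then w ⟨i, h⟩ else ⟨0, by omega⟩
  have hc : IsDynCoverOf shift E (agree k β m) n (Finset.univ.image f : Finset (BetaSeq k β)) := by
    intro x hx
    refine ⟨f (fun i => x i), by simp, ?_⟩
    rw [mem_dynEntourage]
    intro j hj i hi
    simp only [shift_iterate]
    have : j + i < m + n := by omega
    simp [f, this]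
  refine hc.coverMincard_le_card.trans ?_
  refine Nat.cast_le.2 (Finset.card_image_le.trans ?_)
  simp

theorem coverEntropy_lt_top {k : ℕ} (hk : 2 ≤ k) {β : ℝ} [hβ : Fact (1 < β)]
    (E : Set (BetaSeq k β)) : coverEntropy shift E < ⊤ := by
  have h1 : coverEntropy shift E ≤ ENNReal.log ((k : ENNReal) ^ 2) := by
    refine iSup₂_le fun U hU => ?_
    obtain ⟨m, hm⟩ := exists_agree_subset hU
    refine (coverEntropyEntourage_antitone _ _ hm).trans ?_
    rw [← ExpGrowth.expGrowthSup_pow]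
    refine ExpGrowth.expGrowthSup_eventually_monotone ?_
    filter_upwards [Filter.eventually_ge_atTop m] with n hn
    refine (ENat.toENNReal_mono (coverMincard_agree_le hk E m n)).trans ?_
    rw [← pow_mul, ENat.toENNReal_coe]
    norm_cast
    exact Nat.pow_le_pow_right (by omega) (by omega)
  refine h1.trans_lt ?_
  rw [ENNReal.log_lt_top_iff]
  exact ENNReal.pow_lt_top (by simp)

end BetaSeq

/-- If `E ⊆ Σ_k` is shift-invariant, then its Hausdorff dimension with respect to the metric
`d_β` is at most `h_top(E) / log β`, where `h_top` is Bowen's topological entropy of the shift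
restricted to `E` (given by Mathlib's cover entropy, which is `⊥` on `∅` while Bowen's is `0`;
hence the truncation via `toReal`). -/
theorem dimH_le_coverEntropy_div_log (k : ℕ) (hk : 2 ≤ k) (β : ℝ) [Fact (1 < β)]
    (E : Set (BetaSeq k β)) (hE : BetaSeq.shift '' E ⊆ E) :
    dimH E ≤ ENNReal.ofReal (coverEntropy BetaSeq.shift E).toReal /
      ENNReal.ofReal (Real.log β) := by
  classical
  rename_i hβ
  have hb : 1 < β := hβ.out
  have hβ0 : (0:ℝ) < β := lt_trans one_pos hb
  have hlog : 0 < Real.log β := Real.log_pos hb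
  rcases E.eq_empty_or_nonempty with rfl | hne
  · simp
  borelize (BetaSeq k β)
  refine dimH_le fun d hd => ?_
  by_contra hcon
  push Not at hcon
  have htop := (BetaSeq.coverEntropy_lt_top hk E).ne
  have hnn := coverEntropy_nonneg BetaSeq.shift hne
  have hbot : coverEntropy BetaSeq.shift E ≠ ⊥ := by
    intro h
    rw [h] at hnn
    simp at hnn
  have hreal : (coverEntropy BetaSeq.shift E).toReal < d * Real.log β := by
    rw [← ENNReal.ofReal_div_of_pos hlog, ← ENNReal.ofReal_coe_nnreal] at hcon
    have := (ENNReal.ofReal_lt_ofReal_iff_of_nonneg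
      (div_nonneg (EReal.toReal_nonneg hnn) hlog.le)).1 hcon
    rwa [div_lt_iff₀ hlog] at this
  have hlt : coverEntropyEntourage BetaSeq.shift E (BetaSeq.agree k β 1)
      < ((d * Real.log β : ℝ) : EReal) := by
    refine (coverEntropyEntourage_le_coverEntropy _ _ (BetaSeq.agree_mem 1)).trans_lt ?_
    rw [← EReal.coe_toReal htop hbot]
    exact_mod_cast hreal
  have hev := ExpGrowth.eventually_le_exp hlt
  have hcov : ∀ n, ∃ s : Finset (BetaSeq k β),
      IsDynCoverOf BetaSeq.shift E (BetaSeq.agree k β 1) n s ∧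
      s.card = coverMincard BetaSeq.shift E (BetaSeq.agree k β 1) n := fun n =>
    (coverMincard_finite_iff _ _ _ _).1
      ((BetaSeq.coverMincard_agree_le hk E 1 n).trans_lt (ENat.coe_lt_top _))
  choose s hs hcard using hcov
  let t : ∀ n : ℕ, s n → Set (BetaSeq k β) := fun n x => {y | ∀ i < n, y i = x.1 i}
  have hdiam : ∀ n (i : s n), Metric.ediam (t n i) ≤ ENNReal.ofReal ((β⁻¹) ^ n) := by
    intro n i
    refine Metric.ediam_le fun a ha b hb' => ?_
    rw [edist_dist]
    exact ENNReal.ofReal_le_ofReal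
      (BetaSeq.dist_le_of_agree fun j hj => (ha j hj).trans (hb' j hj).symm)
  have hμ : MeasureTheory.Measure.hausdorffMeasure (d : ℝ) E ≤ 1 := by
    refine (MeasureTheory.Measure.hausdorffMeasure_le_liminf_sum (d : ℝ) E
      (l := Filter.atTop) (fun n : ℕ => ENNReal.ofReal ((β⁻¹) ^ n)) ?_ t
      (Filter.Eventually.of_forall hdiam) (Filter.Eventually.of_forall ?_)).trans ?_
    · have := ENNReal.tendsto_ofReal (tendsto_pow_atTop_nhds_zero_of_lt_one
        (inv_nonneg.2 hβ0.le) (inv_lt_one_of_one_lt₀ hb))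
      simpa using this
    · intro n x hx
      obtain ⟨y, hy, hxy⟩ := hs n hx
      refine Set.mem_iUnion.2 ⟨⟨y, hy⟩, fun i hi => ?_⟩
      have := (mem_dynEntourage.1 hxy) i hi 0 one_pos
      simpa [BetaSeq.shift_iterate] using this
    · refine Filter.liminf_le_of_frequently_le' (Filter.Eventually.frequently ?_)
      filter_upwards [hev] with n hn
      rw [← hcard n, ENat.toENNReal_coe] at hn
      have hexp : EReal.exp (((d * Real.log β : ℝ) : EReal) * n)
          = ENNReal.ofReal (Real.exp (d * Real.log β * n)) := by
        rw [← EReal.exp_coe]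
        norm_cast
      rw [hexp] at hn
      calc ∑ i, Metric.ediam (t n i) ^ (d : ℝ)
          ≤ ∑ i : s n, (ENNReal.ofReal ((β⁻¹) ^ n)) ^ (d : ℝ) :=
            Finset.sum_le_sum fun i _ => ENNReal.rpow_le_rpow (hdiam n i) d.2
        _ = ((s n).card : ENNReal) * (ENNReal.ofReal ((β⁻¹) ^ n)) ^ (d : ℝ) := by simp
        _ ≤ ENNReal.ofReal (Real.exp (d * Real.log β * n)) *
              (ENNReal.ofReal ((β⁻¹) ^ n)) ^ (d : ℝ) := by gcongr
        _ = 1 := by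
          have hr : ((β⁻¹) ^ n : ℝ) ^ (d : ℝ) = Real.exp (-(d * Real.log β * n)) := by
            rw [Real.rpow_def_of_pos (by positivity), Real.log_pow, Real.log_inv]
            congr 1
            ring
          rw [ENNReal.ofReal_rpow_of_pos (by positivity), hr,
            ← ENNReal.ofReal_mul (Real.exp_pos _).le, ← Real.exp_add]
          simp
  rw [hd] at hμ
  simp at hμ
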